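/- Fix $n \in \mathbb{N}$ with $n \ge 2$. Let $u, v : \mathbb{N} \to \mathbb{R}$ be the unique solutions of $\beta(m-1,n) y(m-1) + \beta(m,n) y(m+1) = 0$ for all $m \ge 1$ with $u(0) = 1$, $u(1) = 0$, $v(0) = 0$, $v(1) = 1/\beta(0,n)$. Then $u, v \in D(J_n^*)$, and a vector $f \in \ell^2(\mathbb{N};\mathbb{C})$ belongs to the domain of the closure of $J_n$ if and only if $f \in D(J_n^*)$ and $[f,u]_\infty = [f,v]_\infty = 0$, where $[g,h]_\infty := \lim_{M \to \infty} \beta(M,n)\big( g(M)\overline{h(M+1)} - g(M+1)\overline{h(M)} \big)$. -/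

import Mathlib

noncomputable section

open scoped ComplexConjugate
open Filter

/-- The Hilbert space `ℓ²(ℕ; ℂ)`. -/
abbrev H1 : Type := lp (fun _ : ℕ => ℂ) 2

/-- `β(m,n) = (1/2)·√(m+1)·(1-m-n)`. -/
def beta (m n : ℕ) : ℝ := (1 / 2) * Real.sqrt ((m : ℝ) + 1) * (1 - (m : ℝ) - (n : ℝ))

/-- The formal Jacobi action in the row `n`:
`(J_n u)(m) = β(m,n) u(m+1) + β(m-1,n) u(m-1)`, with the convention `β(-1,n) = 0`. -/
def jacobiActRow (n : ℕ) (u : ℕ → ℂ) : ℕ → ℂ := fun m =>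
  (beta m n : ℂ) * u (m + 1) +
    (if m = 0 then 0 else (beta (m - 1) n : ℂ) * u (m - 1))

/-- The bilinear boundary bracket `β(M,n) (g(M) h(M+1) - g(M+1) h(M))`. -/
def boundaryBracket (n : ℕ) (g h : ℕ → ℂ) (M : ℕ) : ℂ :=
  (beta M n : ℂ) * (g M * h (M + 1) - g (M + 1) * h M)

theorem boundaryBracket_swap (n : ℕ) (g h : ℕ → ℂ) (M : ℕ) :
    boundaryBracket n g h M = -boundaryBracket n h g M := by
  unfold boundaryBracket; ring

theorem boundaryBracket_plucker (n : ℕ) (f k u v : ℕ → ℂ) (M : ℕ) :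
    boundaryBracket n f k M * boundaryBracket n u v M =
      boundaryBracket n f u M * boundaryBracket n k v M -
        boundaryBracket n f v M * boundaryBracket n k u M := by
  unfold boundaryBracket; ring

/-- If the brackets of `f` with two solutions of constant bracket `1` vanish at infinity, so does
the bracket of `f` with every `k` whose brackets with these solutions converge. -/
theorem tendsto_boundaryBracket_zero {n : ℕ} {f k u v : ℕ → ℂ} {a b : ℂ}
    (huv : ∀ M, boundaryBracket n u v M = 1)
    (hfu : Tendsto (boundaryBracket n f u) atTop (nhds 0))
    (hfv : Tendsto (boundaryBracket n f v) atTop (nhds 0))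
    (hku : Tendsto (boundaryBracket n u k) atTop (nhds a))
    (hkv : Tendsto (boundaryBracket n v k) atTop (nhds b)) :
    Tendsto (boundaryBracket n f k) atTop (nhds 0) := by
  have key := (hfv.mul hku).sub (hfu.mul hkv)
  simp only [zero_mul, sub_zero] at key
  refine key.congr fun M => ?_
  have := boundaryBracket_plucker n f k u v M
  rw [huv, boundaryBracket_swap n k v, boundaryBracket_swap n k u] at this
  linear_combination -this

/-- Green's formula for the Jacobi action on an initial segment. -/
theorem sum_jacobiActRow_green (n : ℕ) (f h : ℕ → ℂ) (M : ℕ) :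
    ∑ m ∈ Finset.range (M + 1), (f m * jacobiActRow n h m - jacobiActRow n f m * h m) =
      boundaryBracket n f h M := by
  induction M with
  | zero => simp [jacobiActRow, boundaryBracket]; ring
  | succ M ih =>
    rw [Finset.sum_range_succ, ih]
    simp only [jacobiActRow, boundaryBracket, Nat.add_sub_cancel, Nat.succ_ne_zero, if_false]
    ring

theorem conj_jacobiActRow (n : ℕ) (h : ℕ → ℂ) (m : ℕ) :
    conj (jacobiActRow n h m) = jacobiActRow n (fun k => conj (h k)) m := by
  unfold jacobiActRow
  split_ifs <;> simp

/-- Green's formula in `ℓ²`: the boundary bracket converges to the defect of symmetry. -/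
theorem tendsto_boundaryBracket (n : ℕ) (f f' h h' : H1)
    (hf : ∀ m, f' m = jacobiActRow n f m) (hh : ∀ m, h' m = jacobiActRow n h m) :
    Tendsto (boundaryBracket n f (fun m => conj (h m))) atTop
      (nhds (inner ℂ h' f - inner ℂ h f')) := by
  have key := ((lp.hasSum_inner (𝕜 := ℂ) h' f).sub
    (lp.hasSum_inner (𝕜 := ℂ) h f')).tendsto_sum_nat.comp (tendsto_add_atTop_nat 1)
  refine key.congr fun M => ?_
  rw [← sum_jacobiActRow_green]
  refine Finset.sum_congr rfl fun m _ => ?_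
  simp [RCLike.inner_apply, hf, hh, conj_jacobiActRow]

/-- A pair lies in the closure of a subspace of `E × F` iff it is annihilated by the adjoint
subspace. -/
theorem mem_topologicalClosure_iff_adjoint {E F : Type*}
    [NormedAddCommGroup E] [InnerProductSpace ℂ E] [CompleteSpace E]
    [NormedAddCommGroup F] [InnerProductSpace ℂ F] [CompleteSpace F]
    (g : Submodule ℂ (E × F)) (x : E × F) :
    x ∈ g.topologicalClosure ↔
      ∀ y z, (y, z) ∈ g.adjoint → inner ℂ z x.1 = inner ℂ y x.2 := by
  set e := (WithLp.prodContinuousLinearEquiv 2 ℂ E F).symm with he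
  set K : Submodule ℂ (WithLp 2 (E × F)) := g.map (e : E × F →ₗ[ℂ] WithLp 2 (E × F)) with hK
  have hx : x ∈ g.topologicalClosure ↔ e x ∈ Kᗮᗮ := by
    rw [Submodule.orthogonal_orthogonal_eq_closure, ← SetLike.mem_coe, ← SetLike.mem_coe,
      Submodule.topologicalClosure_coe, Submodule.topologicalClosure_coe, hK, Submodule.map_coe]
    change _ ↔ e x ∈ closure (e '' (g : Set (E × F)))
    rw [← e.image_closure, e.injective.mem_set_image]
  have hperp : ∀ y z, WithLp.toLp 2 (-z, y) ∈ Kᗮ ↔ (y, z) ∈ g.adjoint := by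
    intro y z
    rw [Submodule.mem_adjoint_iff, Submodule.mem_orthogonal]
    constructor
    · intro h a b hab
      have := h (e (a, b)) ⟨(a, b), hab, rfl⟩
      simp [he, WithLp.prod_inner_apply] at this
      linear_combination this
    · rintro h _ ⟨⟨a, b⟩, hab, rfl⟩
      have := h a b hab
      simp [he, WithLp.prod_inner_apply]
      linear_combination this
  rw [hx, Submodule.mem_orthogonal]
  constructor
  · intro h y z hyz
    have := h _ ((hperp y z).2 hyz)
    simp [he, WithLp.prod_inner_apply] at this
    linear_combination -this
  · intro h w hw
    have := h w.snd (-w.fst) ((hperp _ _).1 (by simpa using! hw))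
    simp [he, WithLp.prod_inner_apply] at this ⊢
    linear_combination -this

theorem beta_eq_neg (m n : ℕ) :
    beta m n = -(1 / 2 * (Real.sqrt ((m : ℝ) + 1) * ((m : ℝ) + n - 1))) := by
  unfold beta; ring

theorem beta_neg {n : ℕ} (hn : 2 ≤ n) (m : ℕ) : beta m n < 0 := by
  have : (2 : ℝ) ≤ n := by exact_mod_cast hn
  rw [beta_eq_neg, neg_lt_zero]
  have : 0 < (m : ℝ) + n - 1 := by
    have := m.cast_nonneg (α := ℝ)
    linarith
  positivity

/-- Log-concavity of the weights. -/
theorem beta_mul_beta_le {n : ℕ} (hn : 2 ≤ n) (m : ℕ) :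
    beta m n * beta (m + 2) n ≤ beta (m + 1) n ^ 2 := by
  have hn' : (2 : ℝ) ≤ n := by exact_mod_cast hn
  have hm : (0 : ℝ) ≤ m := m.cast_nonneg
  simp only [beta_eq_neg]
  push_cast
  have h1 : Real.sqrt ((m : ℝ) + 1) * Real.sqrt ((m : ℝ) + 2 + 1) ≤ (m : ℝ) + 2 := by
    rw [← Real.sqrt_mul (by positivity), Real.sqrt_le_left (by positivity)]
    nlinarith
  have h2 : Real.sqrt ((m : ℝ) + 1 + 1) ^ 2 = (m : ℝ) + 2 := by
    rw [Real.sq_sqrt (by positivity)]; ring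
  have h3 : ((m : ℝ) + n - 1) * ((m : ℝ) + 2 + n - 1) ≤ ((m : ℝ) + 1 + n - 1) ^ 2 := by nlinarith
  have h4 : 0 ≤ ((m : ℝ) + n - 1) * ((m : ℝ) + 2 + n - 1) :=
    mul_nonneg (by linarith) (by linarith)
  have := mul_le_mul h1 h3 h4 (by positivity)
  nth_rewrite 3 [← h2] at this
  linarith

section Solutions

variable {n : ℕ} {y : ℕ → ℝ}

theorem beta_mul_sq_antitone (hn : 2 ≤ n)
    (hy : ∀ m : ℕ, 1 ≤ m → beta (m - 1) n * y (m - 1) + beta m n * y (m + 1) = 0) (m : ℕ) :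
    -beta (m + 2) n * y (m + 2) ^ 2 ≤ -beta m n * y m ^ 2 := by
  have h0 := beta_neg hn m
  have h1 := beta_neg hn (m + 1)
  have hrec : beta m n * y m + beta (m + 1) n * y (m + 2) = 0 := hy (m + 1) (by omega)
  have hsq : beta (m + 1) n ^ 2 * y (m + 2) ^ 2 = beta m n ^ 2 * y m ^ 2 := by
    linear_combination (beta (m + 1) n * y (m + 2) - beta m n * y m) * hrec
  have hlc := mul_le_mul_of_nonneg_right (beta_mul_beta_le hn m) (sq_nonneg (y (m + 2)))
  rw [hsq] at hlc
  have : 0 ≤ -beta m n * (beta (m + 2) n * y (m + 2) ^ 2 - beta m n * y m ^ 2) := by linarith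
  have := nonneg_of_mul_nonneg_right this (by linarith)
  linarith

theorem exists_beta_mul_sq_le (hn : 2 ≤ n)
    (hy : ∀ m : ℕ, 1 ≤ m → beta (m - 1) n * y (m - 1) + beta m n * y (m + 1) = 0) :
    ∃ C : ℝ, ∀ m, -beta m n * y m ^ 2 ≤ C := by
  refine ⟨max (-beta 0 n * y 0 ^ 2) (-beta 1 n * y 1 ^ 2), fun m => ?_⟩
  induction m using Nat.twoStepInduction with
  | zero => exact le_max_left _ _
  | one => exact le_max_right _ _
  | more m ih _ => exact (beta_mul_sq_antitone hn hy m).trans ih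

theorem summable_sq_of_recurrence (hn : 2 ≤ n)
    (hy : ∀ m : ℕ, 1 ≤ m → beta (m - 1) n * y (m - 1) + beta m n * y (m + 1) = 0) :
    Summable fun m => y m ^ 2 := by
  obtain ⟨C, hC⟩ := exists_beta_mul_sq_le hn hy
  have hn' : (2 : ℝ) ≤ n := by exact_mod_cast hn
  have hs : Summable fun m : ℕ => 2 * C * (1 / ((m + 1 : ℕ) : ℝ) ^ (3 / 2 : ℝ)) :=
    ((summable_nat_add_iff 1).2
      (Real.summable_one_div_nat_rpow.2 (by norm_num : (1 : ℝ) < 3 / 2))).mul_left _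
  refine hs.of_nonneg_of_le (fun m => sq_nonneg _) fun m => ?_
  have hpos : (0 : ℝ) < ((m + 1 : ℕ) : ℝ) := by positivity
  have hpow : ((m + 1 : ℕ) : ℝ) ^ (3 / 2 : ℝ) = Real.sqrt ((m : ℝ) + 1) * ((m : ℝ) + 1) := by
    rw [show (3 / 2 : ℝ) = 1 / 2 + 1 by norm_num, Real.rpow_add hpos, Real.rpow_one,
      ← Real.sqrt_eq_rpow]
    push_cast; rfl
  rw [mul_one_div, le_div_iff₀ (Real.rpow_pos_of_pos hpos _), hpow]
  have h := hC m
  rw [beta_eq_neg] at h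
  have : Real.sqrt ((m : ℝ) + 1) * ((m : ℝ) + 1) ≤ Real.sqrt ((m : ℝ) + 1) * ((m : ℝ) + n - 1) :=
    mul_le_mul_of_nonneg_left (by linarith) (Real.sqrt_nonneg _)
  nlinarith [mul_le_mul_of_nonneg_left this (sq_nonneg (y m))]

theorem memℓp_of_recurrence (hn : 2 ≤ n)
    (hy : ∀ m : ℕ, 1 ≤ m → beta (m - 1) n * y (m - 1) + beta m n * y (m + 1) = 0) :
    Memℓp (fun m : ℕ => (y m : ℂ)) 2 := by
  refine memℓp_gen ((summable_sq_of_recurrence hn hy).congr fun m => ?_)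
  simp [Complex.norm_real]

theorem jacobiActRow_of_recurrence
    (hy : ∀ m : ℕ, 1 ≤ m → beta (m - 1) n * y (m - 1) + beta m n * y (m + 1) = 0)
    {m : ℕ} (hm : m ≠ 0) : jacobiActRow n (fun m => (y m : ℂ)) m = 0 := by
  have h := hy m (Nat.one_le_iff_ne_zero.2 hm)
  rw [jacobiActRow, if_neg hm, add_comm]
  exact_mod_cast h

theorem summable_jacobiActRow_of_recurrence
    (hy : ∀ m : ℕ, 1 ≤ m → beta (m - 1) n * y (m - 1) + beta m n * y (m + 1) = 0) :
    Summable fun m => ‖jacobiActRow n (fun m => (y m : ℂ)) m‖ ^ 2 := by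
  refine summable_of_ne_finset_zero (s := {0}) fun m hm => ?_
  rw [jacobiActRow_of_recurrence hy (by simpa using hm)]
  simp

theorem boundaryBracket_of_recurrence {z : ℕ → ℝ}
    (hy : ∀ m : ℕ, 1 ≤ m → beta (m - 1) n * y (m - 1) + beta m n * y (m + 1) = 0)
    (hz : ∀ m : ℕ, 1 ≤ m → beta (m - 1) n * z (m - 1) + beta m n * z (m + 1) = 0) (M : ℕ) :
    boundaryBracket n (fun m => (y m : ℂ)) (fun m => (z m : ℂ)) M =
      boundaryBracket n (fun m => (y m : ℂ)) (fun m => (z m : ℂ)) 0 := by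
  rw [← sum_jacobiActRow_green, ← sum_jacobiActRow_green, Finset.sum_range_succ']
  simp [jacobiActRow_of_recurrence hy, jacobiActRow_of_recurrence hz]

end Solutions

section JacobiOperator

variable {n : ℕ} {J : H1 →ₗ.[ℂ] H1}

theorem dense_domain_of_finite_support
    (hdom : ∀ w : H1, w ∈ J.domain ↔ {m : ℕ | w m ≠ 0}.Finite) :
    Dense (J.domain : Set H1) := by
  rw [Submodule.dense_iff_topologicalClosure_eq_top, Submodule.topologicalClosure_eq_top_iff,
    Submodule.eq_bot_iff]
  intro w hw
  ext m
  have hmem : lp.single 2 m (1 : ℂ) ∈ J.domain := by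
    rw [hdom]
    refine (Set.finite_singleton m).subset fun k hk => ?_
    by_contra hne
    exact hk (lp.single_apply_ne 2 m _ hne)
  have := (Submodule.mem_orthogonal _ _).1 hw _ hmem
  rw [lp.inner_single_left] at this
  simpa using this

theorem le_adjoint_of_jacobiActRow
    (hact : ∀ w : J.domain, ∀ m : ℕ, (J w : H1) m = jacobiActRow n (⇑(w : H1)) m)
    (hadjdom : ∀ w : H1, w ∈ J.adjoint.domain ↔
      Summable (fun m : ℕ => ‖jacobiActRow n (⇑w) m‖ ^ 2))
    (hadjact : ∀ w : J.adjoint.domain, ∀ m : ℕ,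
      (J.adjoint w : H1) m = jacobiActRow n (⇑(w : H1)) m) :
    J ≤ J.adjoint := by
  refine ⟨fun w hw => ?_, fun x y hxy => ?_⟩
  · rw [hadjdom]
    have := (lp.memℓp (J ⟨w, hw⟩)).summable (by simp)
    simpa [hact] using this
  · ext m
    rw [hact, hadjact, hxy]

/-- The domain of the closure consists of those `f` in the domain of the adjoint whose boundary
bracket with every vector of the domain of the adjoint vanishes at infinity. -/
theorem mem_closure_domain_iff_boundaryBracket
    (hdense : Dense (J.domain : Set H1)) (hle : J ≤ J.adjoint)
    (hadjact : ∀ w : J.adjoint.domain, ∀ m : ℕ,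
      (J.adjoint w : H1) m = jacobiActRow n (⇑(w : H1)) m) (f : H1) :
    f ∈ J.closure.domain ↔ f ∈ J.adjoint.domain ∧ ∀ h ∈ J.adjoint.domain,
      Tendsto (boundaryBracket n f (fun m => conj (h m))) atTop (nhds 0) := by
  have hclosed := LinearPMap.adjoint_isClosed hdense
  have hclosable : J.IsClosable := hclosed.isClosable.leIsClosable hle
  have hgraph : ∀ z, (f, z) ∈ J.closure.graph ↔
      ∀ h : J.adjoint.domain, inner ℂ (J.adjoint h) f = inner ℂ (h : H1) z := by
    intro z
    rw [← hclosable.graph_closure_eq_closure_graph, mem_topologicalClosure_iff_adjoint,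
      ← LinearPMap.adjoint_graph_eq_graph_adjoint hdense]
    constructor
    · exact fun H h => H _ _ (J.adjoint.mem_graph h)
    · rintro H y z hyz
      obtain ⟨h, rfl, rfl⟩ := (LinearPMap.mem_graph_iff _).1 hyz
      exact H h
  rw [LinearPMap.mem_domain_iff]
  constructor
  · rintro ⟨z, hz⟩
    have hz' : (f, z) ∈ J.adjoint.graph := by
      rw [← hclosable.graph_closure_eq_closure_graph] at hz
      exact J.graph.topologicalClosure_minimal (LinearPMap.le_graph_of_le hle) hclosed hz
    obtain ⟨f, rfl, rfl⟩ := (LinearPMap.mem_graph_iff _).1 hz'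
    refine ⟨f.2, fun h hh => ?_⟩
    have := tendsto_boundaryBracket n f (J.adjoint f) h (J.adjoint ⟨h, hh⟩) (hadjact _) (hadjact _)
    rwa [(hgraph _).1 hz ⟨h, hh⟩, sub_self] at this
  · rintro ⟨hf, H⟩
    refine ⟨J.adjoint ⟨f, hf⟩, (hgraph _).2 fun h => sub_eq_zero.1 ?_⟩
    exact tendsto_nhds_unique (tendsto_boundaryBracket n f (J.adjoint ⟨f, hf⟩) h (J.adjoint h)
      (hadjact _) (hadjact _)) (H h h.2)

end JacobiOperator

/-- **Allahverdiev's description of the closure of `J_n`** (`n ≥ 2`): with `u, v` the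
solutions of `β(m-1,n)y(m-1) + β(m,n)y(m+1) = 0` normalized by `u(0)=1, u(1)=0`,
`v(0)=0, v(1)=1/β(0,n)`, we have `u, v ∈ D(J_n*)`, and `f` lies in the domain of the
closure of `J_n` iff `f ∈ D(J_n*)` and `[f,u]_∞ = [f,v]_∞ = 0`. -/
theorem Jn_closure_domain_boundary_conditions
    (n : ℕ) (hn : 2 ≤ n)
    (J : H1 →ₗ.[ℂ] H1)
    (hdom : ∀ w : H1, w ∈ J.domain ↔ {m : ℕ | w m ≠ 0}.Finite)
    (hact : ∀ w : J.domain, ∀ m : ℕ, (J w : H1) m = jacobiActRow n (⇑(w : H1)) m)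
    (hadjdom : ∀ w : H1, w ∈ J.adjoint.domain ↔
      Summable (fun m : ℕ => ‖jacobiActRow n (⇑w) m‖ ^ 2))
    (hadjact : ∀ w : J.adjoint.domain, ∀ m : ℕ,
      (J.adjoint w : H1) m = jacobiActRow n (⇑(w : H1)) m)
    (u v : ℕ → ℝ)
    (hurec : ∀ m : ℕ, 1 ≤ m → beta (m - 1) n * u (m - 1) + beta m n * u (m + 1) = 0)
    (hu0 : u 0 = 1) (hu1 : u 1 = 0)
    (hvrec : ∀ m : ℕ, 1 ≤ m → beta (m - 1) n * v (m - 1) + beta m n * v (m + 1) = 0)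
    (hv0 : v 0 = 0) (hv1 : v 1 = 1 / beta 0 n) :
    (∃ hu2 : Memℓp (fun m : ℕ => (u m : ℂ)) 2,
      (⟨fun m : ℕ => (u m : ℂ), hu2⟩ : H1) ∈ J.adjoint.domain) ∧
    (∃ hv2 : Memℓp (fun m : ℕ => (v m : ℂ)) 2,
      (⟨fun m : ℕ => (v m : ℂ), hv2⟩ : H1) ∈ J.adjoint.domain) ∧
    (∀ f : H1, f ∈ J.closure.domain ↔
      (f ∈ J.adjoint.domain ∧
        Tendsto (fun M : ℕ =>
          (beta M n : ℂ) * (f M * conj ((u (M + 1) : ℂ)) -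
            f (M + 1) * conj ((u M : ℂ)))) atTop (nhds 0) ∧
        Tendsto (fun M : ℕ =>
          (beta M n : ℂ) * (f M * conj ((v (M + 1) : ℂ)) -
            f (M + 1) * conj ((v M : ℂ)))) atTop (nhds 0))) := by
  have hu2 := memℓp_of_recurrence hn hurec
  have hv2 := memℓp_of_recurrence hn hvrec
  have hudom : (⟨fun m : ℕ => (u m : ℂ), hu2⟩ : H1) ∈ J.adjoint.domain :=
    (hadjdom _).2 (summable_jacobiActRow_of_recurrence hurec)
  have hvdom : (⟨fun m : ℕ => (v m : ℂ), hv2⟩ : H1) ∈ J.adjoint.domain :=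
    (hadjdom _).2 (summable_jacobiActRow_of_recurrence hvrec)
  refine ⟨⟨hu2, hudom⟩, ⟨hv2, hvdom⟩, fun f => ?_⟩
  obtain ⟨U, hU, hUdom⟩ : ∃ U : H1, ⇑U = (fun m : ℕ => (u m : ℂ)) ∧ U ∈ J.adjoint.domain :=
    ⟨_, rfl, hudom⟩
  obtain ⟨V, hV, hVdom⟩ : ∃ V : H1, ⇑V = (fun m : ℕ => (v m : ℂ)) ∧ V ∈ J.adjoint.domain :=
    ⟨_, rfl, hvdom⟩
  have hUm (m : ℕ) : (u m : ℂ) = U m := (congrFun hU m).symm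
  have hVm (m : ℕ) : (v m : ℂ) = V m := (congrFun hV m).symm
  have hUV : ∀ M, boundaryBracket n U V M = 1 := by
    intro M
    have hb : (beta 0 n : ℂ) ≠ 0 := by exact_mod_cast (beta_neg hn 0).ne
    rw [hU, hV, boundaryBracket_of_recurrence hurec hvrec]
    simp [boundaryBracket, hu0, hu1, hv0, hv1, hb]
  have hUconj : (fun m => conj (U m)) = ⇑U := by simp [hU]
  have hVconj : (fun m => conj (V m)) = ⇑V := by simp [hV]
  rw [mem_closure_domain_iff_boundaryBracket (dense_domain_of_finite_support hdom)
    (le_adjoint_of_jacobiActRow hact hadjdom hadjact) hadjact]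
  simp only [hUm, hVm]
  change _ ↔ _ ∧ Tendsto (boundaryBracket n f fun m => conj (U m)) atTop (nhds 0) ∧
    Tendsto (boundaryBracket n f fun m => conj (V m)) atTop (nhds 0)
  constructor
  · rintro ⟨hf, H⟩
    exact ⟨hf, H U hUdom, H V hVdom⟩
  · rw [hUconj, hVconj]
    rintro ⟨hf, hfu, hfv⟩
    refine ⟨hf, fun h hh => ?_⟩
    have hlim (w : H1) (hw : w ∈ J.adjoint.domain) :=
      tendsto_boundaryBracket n w (J.adjoint ⟨w, hw⟩) h (J.adjoint ⟨h, hh⟩)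
        (hadjact _) (hadjact _)
    exact tendsto_boundaryBracket_zero hUV hfu hfv (hlim U hUdom) (hlim V hVdom)
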